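/- arXiv:2604.12550 — 3 statements merged into one kernel-verified Lean document; each statement's English description precedes it below -/
import Mathlib

section
/- Let Q be a finite quandle, Z₀ = ker θ_{G(Q)}, and N a subgroup of Z₀ that is torsion-free and such that every element of Z₀ is a product of an element of N and an element of Z₀ of finite order. Let ρ : G(Q) → GL(V) be an irreducible group representation over ℂ. Then there exists a group homomorphism χ : G(Q) → ℂˣ such that χ(n) ρ(n) = id_V for all n ∈ N. -/
open scoped Quandles
/-- The inner automorphism group of a rack/quandle `Q`: the subgroup of permutations
of `Q` generated by the left translations `L_x = Rack.act' x`. -/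
def QdlInn (Q : Type*) [Rack Q] : Subgroup (Equiv.Perm Q) :=
  Subgroup.closure (Set.range (Rack.act' (R := Q)))

/-- The quandle morphism `θ : Q → Conj (Inn Q)`, `x ↦ L_x`. -/
def QdlTheta (Q : Type*) [Rack Q] : ShelfHom Q (Quandle.Conj (QdlInn Q)) where
  toFun x := ⟨Rack.act' x, Subgroup.subset_closure ⟨x, rfl⟩⟩
  map_act' := by
    intro x y
    simp only [Quandle.conj_act_eq_conj]
    exact Subtype.ext (Rack.ad_conj x y)

/-- The induced group morphism `θ_{G(Q)} : G(Q) → Inn(Q)`. -/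
def QdlThetaG (Q : Type*) [Rack Q] : Rack.EnvelGroup Q →* QdlInn Q :=
  Rack.toEnvelGroup.map (QdlTheta Q)

/-- `Z₀`, the kernel of `θ_{G(Q)}`. -/
def QdlZ0 (Q : Type*) [Rack Q] : Subgroup (Rack.EnvelGroup Q) :=
  (QdlThetaG Q).ker

section Reps

variable {Q : Type*} {V : Type*} [AddCommGroup V] [Module ℂ V]

/-- `ρ : Q → GL(V)` is a quandle (rack) representation: `ρ(x ◃ y) = ρ(x) ρ(y) ρ(x)⁻¹`. -/
def IsQdlRep [Shelf Q] (ρ : Q → (V →ₗ[ℂ] V)ˣ) : Prop :=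
  ∀ x y : Q, ρ (x ◃ y) = ρ x * ρ y * (ρ x)⁻¹

/-- A family `ρ : Q → GL(V)` is irreducible if the only subspaces invariant
under all `ρ x` are `0` and `V`. -/
def QdlIrred (ρ : Q → (V →ₗ[ℂ] V)ˣ) : Prop :=
  ∀ W : Submodule ℂ V, (∀ x : Q, ∀ v ∈ W, (ρ x : V →ₗ[ℂ] V) v ∈ W) → W = ⊥ ∨ W = ⊤

/-- A group representation `σ : G →* GL(V)` is irreducible if the only subspaces
invariant under all `σ g` are `0` and `V`. -/
def GrpIrred {G : Type*} [Group G] (σ : G →* (V →ₗ[ℂ] V)ˣ) : Prop :=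
  ∀ W : Submodule ℂ V, (∀ g : G, ∀ v ∈ W, (σ g : V →ₗ[ℂ] V) v ∈ W) → W = ⊥ ∨ W = ⊤

end Reps

/-- A character of a quandle: a map `χ : Q → ℂˣ` with `χ(x ◃ y) = χ(y)`. -/
def QdlChar {Q : Type*} [Shelf Q] (χ : Q → ℂˣ) : Prop :=
  ∀ x y : Q, χ (x ◃ y) = χ y

open Polynomial in
/-- Dixmier's countable-dimension Schur lemma for `GrpIrred`. -/
theorem schur_countable_aux {G : Type*} [Group G] [Countable G] {V : Type*} [AddCommGroup V]
    [Module ℂ V] [Nontrivial V] (σ : G →* (V →ₗ[ℂ] V)ˣ) (hσ : GrpIrred σ)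
    (T : Module.End ℂ V) (hT : ∀ g v, T ((σ g : V →ₗ[ℂ] V) v) = (σ g : V →ₗ[ℂ] V) (T v)) :
    ∃ c : ℂ, T = algebraMap ℂ (Module.End ℂ V) c := by
  classical
  by_contra hne
  push Not at hne
  have hunit : ∀ c : ℂ, IsUnit (algebraMap ℂ (Module.End ℂ V) c - T) := by
    intro c
    set S : Module.End ℂ V := algebraMap ℂ (Module.End ℂ V) c - T with hS
    have hS0 : S ≠ 0 := fun h => hne c (sub_eq_zero.1 h).symm
    have hcomm : ∀ g v, S ((σ g : V →ₗ[ℂ] V) v) = (σ g : V →ₗ[ℂ] V) (S v) := by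
      intro g v
      simp [hS, Module.algebraMap_end_apply, hT]
    rw [Module.End.isUnit_iff]
    constructor
    · rw [← LinearMap.ker_eq_bot]
      refine (hσ (LinearMap.ker S) ?_).resolve_right ?_
      · intro g v hv
        rw [LinearMap.mem_ker] at hv ⊢
        rw [hcomm, hv, map_zero]
      · intro h
        exact hS0 (LinearMap.ker_eq_top.1 h)
    · rw [← LinearMap.range_eq_top]
      refine (hσ (LinearMap.range S) ?_).resolve_left ?_
      · rintro g _ ⟨w, rfl⟩
        exact ⟨_, hcomm g w⟩
      · intro h
        exact hS0 (LinearMap.range_eq_bot.1 h)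
  have hpoly : ∀ p : ℂ[X], p ≠ 0 → IsUnit (aeval T p) := by
    intro p hp
    by_contra hk
    rw [(IsAlgClosed.splits p).eq_prod_roots, aeval_mul,
      ((Commute.all _ _).map (aeval T : ℂ[X] →ₐ[ℂ] _)).isUnit_mul_iff, aeval_C] at hk
    have hlu : IsUnit (algebraMap ℂ (Module.End ℂ V) p.leadingCoeff) :=
      (IsUnit.mk0 _ (leadingCoeff_ne_zero.2 hp)).map _
    obtain ⟨r, hr, -⟩ := spectrum.exists_mem_of_not_isUnit_aeval_prod (not_and.1 hk hlu)
    exact hr (hunit r)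
  obtain ⟨v, hv⟩ := exists_ne (0 : V)
  have hfac : ∀ c : ℂ, ∃ w : V, aeval T (X - C c) w = v := by
    intro c
    have := (Module.End.isUnit_iff _).1 (hpoly (X - C c) (X_sub_C_ne_zero c))
    exact this.2 v
  choose w hw using hfac
  have hli : LinearIndependent ℂ w := by
    refine linearIndependent_iff'.2 fun s m hm i hi => ?_
    have hmul : ∀ j ∈ s, aeval T (∏ k ∈ s, (X - C k)) (w j)
        = aeval T (∏ k ∈ s.erase j, (X - C k)) v := by
      intro j hj
      rw [← Finset.prod_erase_mul _ _ hj, map_mul, Module.End.mul_apply, hw]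
    let p : ℂ[X] := ∑ j ∈ s, C (m j) * ∏ k ∈ s.erase j, (X - C k)
    have hpv : aeval T p v = 0 := by
      have h1 := congrArg (aeval T (∏ k ∈ s, (X - C k))) hm
      rw [map_zero, map_sum] at h1
      rw [← h1]
      simp only [p, map_sum, LinearMap.sum_apply, map_mul, aeval_C, Module.End.mul_apply,
        Module.algebraMap_end_apply, map_smul]
      refine Finset.sum_congr rfl fun j hj => ?_
      rw [hmul j hj]
    have hp0 : p = 0 := by
      by_contra hp
      have := (Module.End.isUnit_iff _).1 (hpoly p hp)
      exact hv (this.1 (by rw [hpv, map_zero]))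
    have he := congrArg (eval i) hp0
    have h2 : ∀ j ∈ s, j ≠ i → m j * ∏ k ∈ s.erase j, (i - k) = 0 := by
      intro j hj hji
      rw [Finset.prod_eq_zero (Finset.mem_erase.2 ⟨hji.symm, hi⟩) (sub_self i), mul_zero]
    simp only [p, eval_finsetSum, eval_mul, eval_C, eval_prod, eval_sub, eval_X, eval_zero] at he
    rw [Finset.sum_eq_single_of_mem i hi h2] at he
    refine (mul_eq_zero.1 he).resolve_right (Finset.prod_ne_zero_iff.2 fun k hk => ?_)
    exact sub_ne_zero.2 (Finset.ne_of_mem_erase hk).symm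
  have hspan : Submodule.span ℂ (Set.range fun g : G => (σ g : V →ₗ[ℂ] V) v) = ⊤ := by
    refine (hσ _ ?_).resolve_left ?_
    · intro g x hx
      induction hx using Submodule.span_induction with
      | mem x h =>
        obtain ⟨k, rfl⟩ := h
        exact Submodule.subset_span ⟨g * k, by simp⟩
      | zero => simp
      | add x y _ _ hx hy => rw [map_add]; exact Submodule.add_mem _ hx hy
      | smul a x _ hx => rw [map_smul]; exact Submodule.smul_mem _ _ hx
    · intro h
      have : v ∈ Submodule.span ℂ (Set.range fun g : G => (σ g : V →ₗ[ℂ] V) v) :=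
        Submodule.subset_span ⟨1, by simp⟩
      rw [h] at this
      exact hv ((Submodule.mem_bot ℂ).1 this)
  have hrank : Module.rank ℂ V ≤ Cardinal.aleph0 := by
    rw [← rank_top, ← hspan]
    refine (rank_span_le _).trans ?_
    exact Cardinal.mk_le_aleph0_iff.2 (Set.countable_range _).to_subtype
  have h3 := hli.cardinal_lift_le_rank
  rw [Cardinal.mk_complex] at h3
  have h4 := h3.trans (Cardinal.lift_le.2 hrank)
  simp at h4
  exact absurd h4 (not_le.2 Cardinal.aleph0_lt_continuum)

theorem envel_induction_aux {Q : Type*} [Rack Q] (P : Rack.EnvelGroup Q → Prop)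
    (h1 : P 1) (hi : ∀ x : Q, P (Rack.toEnvelGroup Q x))
    (hm : ∀ a b, P a → P b → P (a * b)) (hinv : ∀ a, P a → P a⁻¹) : ∀ g, P g := by
  intro g
  induction g using Quotient.inductionOn with
  | h a =>
    induction a with
    | unit => exact h1
    | incl x => exact hi x
    | mul a b ha hb => exact hm _ _ ha hb
    | inv a ha => exact hinv _ ha

theorem envel_countable_aux (Q : Type*) [Rack Q] [Finite Q] : Countable (Rack.EnvelGroup Q) := by
  have hF : Countable (FreeGroup Q) := by
    unfold FreeGroup
    exact Quot.mk_surjective.countable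
  let φ : FreeGroup Q →* Rack.EnvelGroup Q :=
    FreeGroup.lift fun x : Q => (Rack.toEnvelGroup Q x : Rack.EnvelGroup Q)
  have hφ : Function.Surjective φ := by
    intro g
    refine envel_induction_aux (fun g => ∃ a, φ a = g) ⟨1, map_one _⟩ ?_ ?_ ?_ g
    · intro x
      exact ⟨FreeGroup.of x, FreeGroup.lift_apply_of⟩
    · rintro _ _ ⟨a, rfl⟩ ⟨b, rfl⟩
      exact ⟨a * b, map_mul _ _ _⟩
    · rintro _ ⟨a, rfl⟩
      exact ⟨a⁻¹, map_inv _ _⟩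
  exact hφ.countable

theorem envel_conj_aux {Q : Type*} [Rack Q] (g : Rack.EnvelGroup Q) : ∀ y : Q,
    g * (Rack.toEnvelGroup Q y : Rack.EnvelGroup Q) * g⁻¹
      = (Rack.toEnvelGroup Q ((QdlThetaG Q g : Equiv.Perm Q) y) : Rack.EnvelGroup Q) := by
  refine envel_induction_aux (fun g => ∀ y : Q,
    g * (Rack.toEnvelGroup Q y : Rack.EnvelGroup Q) * g⁻¹
      = (Rack.toEnvelGroup Q ((QdlThetaG Q g : Equiv.Perm Q) y) : Rack.EnvelGroup Q)) ?_ ?_ ?_ ?_ g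
  · intro y
    rw [map_one, one_mul, inv_one, mul_one]
    rfl
  · intro x y
    exact ((Rack.toEnvelGroup Q).map_act (x := x) (y := y)).symm
  · intro a b ha hb y
    rw [map_mul, Subgroup.coe_mul, Equiv.Perm.mul_apply, ← ha, ← hb]
    group
  · intro a ha y
    have := ha ((QdlThetaG Q a⁻¹ : Equiv.Perm Q) y)
    rw [map_inv, Subgroup.coe_inv, ← Equiv.Perm.mul_apply, mul_inv_cancel, Equiv.Perm.one_apply] at this
    rw [map_inv, Subgroup.coe_inv, ← this]
    group

theorem Z0_central_aux (Q : Type*) [Rack Q] : QdlZ0 Q ≤ Subgroup.center (Rack.EnvelGroup Q) := by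
  intro z hz
  rw [Subgroup.mem_center_iff]
  have hz' : QdlThetaG Q z = 1 := hz
  refine envel_induction_aux (fun g => g * z = z * g) (by simp) ?_ ?_ ?_
  · intro x
    have := envel_conj_aux z x
    rw [hz'] at this
    exact (mul_inv_eq_iff_eq_mul.1 this).symm
  · intro a b (ha : Commute a z) (hb : Commute b z)
    exact ha.mul_left hb
  · intro a (ha : Commute a z)
    exact ha.inv_left

theorem divisible_extend_aux {A B : Type*} [Group A] [Group B]
    (hB : ∀ a b : B, a * b = b * a) (f : A →* B)
    (hf : Function.Injective f) (l : A →* ℂˣ) : ∃ h : B →* ℂˣ, ∀ a, h (f a) = l a := by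
  let _ : CommGroup B := { (inferInstance : Group B) with mul_comm := hB }
  let _ : CommGroup A := { (inferInstance : Group A) with
    mul_comm := fun a b => hf (by rw [map_mul, map_mul, hB]) }
  have hsurj : ∀ {n : ℕ}, n ≠ 0 → Function.Surjective fun a : Additive ℂˣ => n • a := by
    intro n hn a
    obtain ⟨z, hz⟩ := IsAlgClosed.exists_pow_nat_eq ((a.toMul : ℂˣ) : ℂ) (Nat.pos_of_ne_zero hn)
    have hz0 : z ≠ 0 := by
      rintro rfl
      rw [zero_pow hn] at hz
      exact (a.toMul).ne_zero hz.symm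
    refine ⟨Additive.ofMul (Units.mk0 z hz0), ?_⟩
    apply Additive.toMul.injective
    ext
    simpa using hz
  let _ : DivisibleBy (Additive ℂˣ) ℕ := divisibleByOfSMulRightSurj _ _ hsurj
  let _ : DivisibleBy (Additive ℂˣ) ℤ := AddGroup.divisibleByIntOfDivisibleByNat _
  obtain ⟨h, hh⟩ := (Module.Baer.of_divisible (Additive ℂˣ)).extension_property_addMonoidHom
    (MonoidHom.toAdditive f) hf (MonoidHom.toAdditive l)
  refine ⟨MonoidHom.toAdditive.symm h, fun a => ?_⟩
  exact DFunLike.congr_fun hh (Additive.ofMul a)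

/-- with `N` as in Statement 14, every irreducible representation `ρ` of the
group `G(Q)` becomes trivial on `N` after twisting by a suitable multiplicative character. -/
theorem stmt15 (Q : Type*) [Quandle Q] [Finite Q] (N : Subgroup (Rack.EnvelGroup Q))
    (hNZ : N ≤ QdlZ0 Q)
    (htf : ∀ n ∈ N, IsOfFinOrder n → n = 1)
    (hdecomp : ∀ z ∈ QdlZ0 Q, ∃ n ∈ N, ∃ t ∈ QdlZ0 Q, IsOfFinOrder t ∧ z = n * t)
    (V : Type*) [AddCommGroup V] [Module ℂ V]
    (ρ : Rack.EnvelGroup Q →* (V →ₗ[ℂ] V)ˣ) (hρ : GrpIrred ρ) :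
    ∃ χ : Rack.EnvelGroup Q →* ℂˣ,
      ∀ n ∈ N, (χ n : ℂ) • ((ρ n : V →ₗ[ℂ] V)) = LinearMap.id := by
  classical
  rcases subsingleton_or_nontrivial V with hV | hV
  · exact ⟨1, fun n _ => LinearMap.ext fun v => Subsingleton.elim _ _⟩
  have := envel_countable_aux Q
  have hcen : N ≤ Subgroup.center (Rack.EnvelGroup Q) := hNZ.trans (Z0_central_aux Q)
  have : (QdlZ0 Q).FiniteIndex := by
    unfold QdlZ0
    infer_instance
  have : (Subgroup.center (Rack.EnvelGroup Q)).FiniteIndex :=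
    Subgroup.finiteIndex_of_le (Z0_central_aux Q)
  have hsc : ∀ n : N, ∃ c : ℂ,
      (ρ (n : Rack.EnvelGroup Q) : Module.End ℂ V) = algebraMap ℂ (Module.End ℂ V) c := by
    intro n
    refine schur_countable_aux ρ hρ _ fun g v => ?_
    have h := Subgroup.mem_center_iff.1 (hcen n.2) g
    have h' := congrArg (fun x => (ρ x : Module.End ℂ V) v) h
    simpa using h'.symm
  choose c hc using hsc
  have hinj : Function.Injective (algebraMap ℂ (Module.End ℂ V)) :=
    FaithfulSMul.algebraMap_injective _ _
  have hc1 : c 1 = 1 := hinj (by rw [← hc]; simp)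
  have hcm : ∀ a b, c (a * b) = c a * c b := fun a b =>
    hinj (by rw [map_mul, ← hc, ← hc, ← hc]; simp)
  let l0 : N →* ℂ := ⟨⟨c, hc1⟩, hcm⟩
  let l : N →* ℂˣ := l0.toHomUnits
  have hl : ∀ n, (l n : ℂ) = c n := fun n => rfl
  let τ := MonoidHom.transferCenterPow (Rack.EnvelGroup Q)
  let f : N →* Subgroup.center (Rack.EnvelGroup Q) := τ.comp N.subtype
  have hf : Function.Injective f := by
    rw [injective_iff_map_eq_one]
    intro a ha
    have h1 : (a : Rack.EnvelGroup Q) ^ (Subgroup.center (Rack.EnvelGroup Q)).index = 1 :=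
      congrArg Subtype.val ha
    refine Subtype.ext (htf a a.2 (isOfFinOrder_iff_pow_eq_one.2 ⟨_, ?_, h1⟩))
    exact Nat.pos_of_ne_zero Subgroup.FiniteIndex.index_ne_zero
  obtain ⟨h, hh⟩ := divisible_extend_aux
    (fun a b => Subtype.ext (Subgroup.mem_center_iff.1 b.2 a)) f hf l⁻¹
  refine ⟨h.comp τ, fun n hn => ?_⟩
  have e1 : (h.comp τ) n = (l ⟨n, hn⟩)⁻¹ := hh ⟨n, hn⟩
  have e2 : (ρ n : Module.End ℂ V) = algebraMap ℂ (Module.End ℂ V) (l ⟨n, hn⟩ : ℂ) := hc ⟨n, hn⟩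
  rw [e1]
  ext v
  rw [LinearMap.smul_apply, e2, Module.algebraMap_end_apply, smul_smul, Units.inv_mul, one_smul]
  rfl
end

section
/- For every finite quandle Q, there is an injective group homomorphism from the torsion subgroup of Z₀ = ker θ_{G(Q)} into the Schur multiplier H²(Inn(Q), ℂˣ). -/
open scoped Quandles
/-- The `ℂˣ`-valued 2-cocycles on a group `G` (trivial action), as a subgroup of `G → G → ℂˣ`. -/
def TwoCocycles (G : Type*) [Group G] : Subgroup (G → G → ℂˣ) where
  carrier := {α | ∀ g h k : G, α g h * α (g * h) k = α h k * α g (h * k)}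
  one_mem' := by intro g h k; simp
  mul_mem' := by
    intro α β hα hβ g h k
    simp only [Pi.mul_apply]
    rw [mul_mul_mul_comm, hα, hβ, mul_mul_mul_comm]
  inv_mem' := by
    intro α hα g h k
    simp only [Pi.inv_apply]
    rw [← mul_inv, ← mul_inv, hα]

/-- The coboundary homomorphism `(G → ℂˣ) →* (G → G → ℂˣ)`,
`β ↦ ((g,h) ↦ β g * β h * (β (g*h))⁻¹)`. -/
def CobdHom (G : Type*) [Group G] : (G → ℂˣ) →* (G → G → ℂˣ) where
  toFun β := fun g h => β g * β h * (β (g * h))⁻¹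
  map_one' := by funext g h; simp
  map_mul' β γ := by
    funext g h
    simp only [Pi.mul_apply, mul_inv]
    simp [mul_comm, mul_assoc, mul_left_comm]

/-- The `ℂˣ`-valued 2-coboundaries on `G`. -/
def TwoCoboundaries (G : Type*) [Group G] : Subgroup (G → G → ℂˣ) :=
  (CobdHom G).range

/-- The Schur multiplier `H²(G, ℂˣ)`: 2-cocycles modulo 2-coboundaries. -/
def SchurMultiplier (G : Type*) [Group G] :=
  TwoCocycles G ⧸ (TwoCoboundaries G).subgroupOf (TwoCocycles G)

noncomputable instance (G : Type*) [Group G] : CommGroup (SchurMultiplier G) :=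
  inferInstanceAs (CommGroup (TwoCocycles G ⧸ (TwoCoboundaries G).subgroupOf (TwoCocycles G)))

theorem aux_retract (A : Type*) [CommGroup A] [Group.FG A] :
    Finite (CommGroup.torsion A) ∧
    ∃ r : A →* CommGroup.torsion A, ∀ a : CommGroup.torsion A, r a = a := by
  have hfin : Module.Finite ℤ (Additive A) := Module.Finite.iff_addGroup_fg.mpr inferInstance
  obtain ⟨f, hf⟩ := Module.projective_lifting_property _ LinearMap.id
    (Submodule.torsion ℤ (Additive A)).mkQ_surjective
  have key : ∀ a : A, IsOfFinOrder a ↔ Additive.ofMul a ∈ Submodule.torsion ℤ (Additive A) := by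
    intro a
    rw [isOfFinOrder_iff_zpow_eq_one, Submodule.mem_torsion_iff]
    constructor
    · rintro ⟨n, hn, h⟩
      exact ⟨⟨n, mem_nonZeroDivisors_of_ne_zero hn⟩, h⟩
    · rintro ⟨n, h⟩
      exact ⟨n, nonZeroDivisors.ne_zero n.2, h⟩
  let p : Additive A →ₗ[ℤ] Additive A :=
    LinearMap.id - f.comp (Submodule.torsion ℤ (Additive A)).mkQ
  have hp : ∀ x, p x ∈ Submodule.torsion ℤ (Additive A) := by
    intro x
    rw [← Submodule.Quotient.mk_eq_zero, ← Submodule.mkQ_apply]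
    have := LinearMap.congr_fun hf ((Submodule.torsion ℤ (Additive A)).mkQ x)
    simp only [LinearMap.comp_apply, LinearMap.id_apply] at this
    simp only [p, LinearMap.sub_apply, LinearMap.comp_apply, LinearMap.id_apply, map_sub, this,
      sub_self]
  have hp' : ∀ x ∈ Submodule.torsion ℤ (Additive A), p x = x := by
    intro x hx
    have : (Submodule.torsion ℤ (Additive A)).mkQ x = 0 := by simpa using hx
    simp only [p, LinearMap.sub_apply, LinearMap.comp_apply, LinearMap.id_apply, this, map_zero,
      sub_zero]
  let q : A →* A := MonoidHom.toAdditive.symm p.toAddMonoidHom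
  let r : A →* CommGroup.torsion A := q.codRestrict _ (fun a => (key _).2 (hp (Additive.ofMul a)))
  have hr : ∀ a : CommGroup.torsion A, r a = a := fun a =>
    Subtype.ext (hp' (Additive.ofMul (a : A)) ((key _).1 a.2))
  refine ⟨?_, r, hr⟩
  have : Group.FG (CommGroup.torsion A) := Group.fg_of_surjective (f := r) (fun a => ⟨a, hr a⟩)
  exact CommGroup.finite_of_fg_isMulTorsion _ (fun a => Submonoid.isOfFinOrder_coe.1 a.2)

theorem aux_tau {G H K : Type*} [Group G] [Group H] [CommGroup K] (θ : G →* H)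
    (hθ : Function.Surjective θ) (i : K →* G) (hi : Function.Injective i)
    (hr : ∀ x, θ x = 1 → ∃ k, i k = x) (hr' : ∀ k, θ (i k) = 1)
    (hc : ∀ k g, i k * g = g * i k) :
    ∃ τ : (K →* ℂˣ) →* SchurMultiplier H, ∀ χ, τ χ = 1 →
      ∃ Φ : G →* ℂˣ, ∀ k, Φ (i k) = χ k := by
  choose s hs using hθ
  have h1 : ∀ g h, ∃ k, i k = s g * s h * (s (g * h))⁻¹ := by
    intro g h; apply hr; simp [hs]
  choose a ha using h1
  have h2 : ∀ x, ∃ k, i k = x * (s (θ x))⁻¹ := by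
    intro x; apply hr; simp [hs]
  choose p hp using h2
  have hpm : ∀ x y, p (x * y) = p x * p y * a (θ x) (θ y) := by
    intro x y
    apply hi
    rw [map_mul, map_mul, mul_assoc, hc (p y), ha, hp, hp, hp, map_mul]
    have := hc (p y) (s (θ y) * (s (θ x * θ y))⁻¹)
    rw [hp] at this
    calc x * y * (s (θ x * θ y))⁻¹
        = x * ((y * (s (θ y))⁻¹) * (s (θ y) * (s (θ x * θ y))⁻¹)) := by group
      _ = _ := by rw [this]; group
  have hac : ∀ g h k, a g h * a (g * h) k = a h k * a g (h * k) := by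
    intro g h k
    apply hi
    have := hc (a h k) (s g)
    rw [map_mul, map_mul, ha g (h * k), ← mul_assoc, ← mul_assoc, this]
    simp only [ha, mul_assoc]
    group
  let c : (K →* ℂˣ) →* TwoCocycles H :=
    { toFun := fun χ => ⟨fun g h => χ (a g h), fun g h k => by
        rw [← map_mul, ← map_mul, hac]⟩
      map_one' := rfl
      map_mul' := fun _ _ => rfl }
  let τ : (K →* ℂˣ) →* SchurMultiplier H :=
    (QuotientGroup.mk' ((TwoCoboundaries H).subgroupOf (TwoCocycles H))).comp c
  refine ⟨τ, fun χ hχ => ?_⟩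
  have hχ' : c χ ∈ (TwoCoboundaries H).subgroupOf (TwoCocycles H) :=
    (QuotientGroup.eq_one_iff _).1 hχ
  obtain ⟨β, hβ⟩ := (Subgroup.mem_subgroupOf).1 hχ'
  have hβ' : ∀ g h, χ (a g h) = β g * β h * (β (g * h))⁻¹ := fun g h =>
    (congrFun (congrFun hβ g) h).symm
  refine ⟨MonoidHom.mk' (fun x => χ (p x) * β (θ x)) ?_, ?_⟩
  · intro x y
    rw [hpm, map_mul, map_mul, hβ', map_mul]
    rw [mul_assoc, inv_mul_cancel_right]
    exact mul_mul_mul_comm _ _ _ _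
  · intro k
    change χ (p (i k)) * β (θ (i k)) = χ k
    have e1 : k = p (i k) * a 1 1 := by
      apply hi
      rw [map_mul, hp, ha, hr']
      simp
    have e2 := hβ' 1 1
    rw [mul_one, mul_inv_cancel_right] at e2
    rw [hr', ← e2, ← map_mul, ← e1]

theorem aux_closure (Q : Type*) [Rack Q] :
    Subgroup.closure (Set.range (Rack.toEnvelGroup Q : Q → Rack.EnvelGroup Q)) = ⊤ := by
  rw [eq_top_iff]
  rintro x -
  refine Quotient.inductionOn x fun x => ?_
  induction x with
  | unit => exact Subgroup.one_mem _
  | incl x => exact Subgroup.subset_closure ⟨x, rfl⟩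
  | mul x y hx hy => exact Subgroup.mul_mem _ hx hy
  | inv x hx => exact Subgroup.inv_mem _ hx

theorem aux_theta_apply {Q : Type*} [Rack Q] (x : Q) :
    (QdlThetaG Q (Rack.toEnvelGroup Q x) : Equiv.Perm Q) = Rack.act' x := rfl

theorem aux_conj {Q : Type*} [Rack Q] (z : Rack.EnvelGroup Q) : ∀ y : Q,
    z * (show Rack.EnvelGroup Q from Rack.toEnvelGroup Q y) * z⁻¹ =
      (show Rack.EnvelGroup Q from Rack.toEnvelGroup Q ((QdlThetaG Q z : Equiv.Perm Q) y)) := by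
  have hz : z ∈ Subgroup.closure (Set.range (Rack.toEnvelGroup Q : Q → Rack.EnvelGroup Q)) := by
    rw [aux_closure]; trivial
  induction hz using Subgroup.closure_induction with
  | mem x hx =>
    obtain ⟨x, rfl⟩ := hx
    intro y
    exact ((Rack.toEnvelGroup Q).map_act' (x := x) (y := y)).symm
  | one => intro y; simp
  | mul a b _ _ ha hb =>
    intro y
    rw [map_mul, Subgroup.coe_mul, Equiv.Perm.mul_apply, ← ha, ← hb]
    group
  | inv a _ ha =>
    intro y
    have := ha (((QdlThetaG Q a⁻¹ : QdlInn Q) : Equiv.Perm Q) y)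
    rw [← Equiv.Perm.mul_apply, ← Subgroup.coe_mul, ← map_mul, mul_inv_cancel, map_one] at this
    simp only [Subgroup.coe_one, Equiv.Perm.one_apply] at this
    rw [← this]
    group

theorem aux_central {Q : Type*} [Rack Q] (z : Rack.EnvelGroup Q) (hz : QdlThetaG Q z = 1)
    (g : Rack.EnvelGroup Q) : z * g = g * z := by
  have hg : g ∈ Subgroup.closure (Set.range (Rack.toEnvelGroup Q : Q → Rack.EnvelGroup Q)) := by
    rw [aux_closure]; trivial
  have : Subgroup.closure (Set.range (Rack.toEnvelGroup Q : Q → Rack.EnvelGroup Q)) ≤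
      Subgroup.centralizer {z} := by
    rw [Subgroup.closure_le]
    rintro _ ⟨y, rfl⟩
    have := aux_conj z y
    rw [hz] at this
    simp only [Subgroup.coe_one, Equiv.Perm.one_apply] at this
    rw [mul_inv_eq_iff_eq_mul] at this
    refine Subgroup.mem_centralizer_iff.2 ?_
    rintro _ rfl
    exact this
  exact Subgroup.mem_centralizer_iff.1 (this hg) z rfl

theorem aux_surj (Q : Type*) [Rack Q] : Function.Surjective (QdlThetaG Q) := by
  rintro ⟨w, hw⟩
  have : w ∈ (QdlThetaG Q).range.map (QdlInn Q).subtype := by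
    have h : QdlInn Q ≤ (QdlThetaG Q).range.map (QdlInn Q).subtype := by
      refine (Subgroup.closure_le _).2 ?_
      rintro _ ⟨x, rfl⟩
      exact ⟨_, ⟨Rack.toEnvelGroup Q x, rfl⟩, rfl⟩
    exact h hw
  obtain ⟨_, ⟨g, rfl⟩, h⟩ := this
  exact ⟨g, Subtype.ext h⟩

theorem aux_char {Q : Type*} [Rack Q] (φ : Rack.EnvelGroup Q →* ℂˣ) (t : Rack.EnvelGroup Q)
    (ht : IsOfFinOrder t) : φ t = 1 := by
  have hc : ∀ x y : Q, φ (Rack.toEnvelGroup Q (x ◃ y)) = φ (Rack.toEnvelGroup Q y) := by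
    intro x y
    have h := (Rack.toEnvelGroup Q).map_act' (x := x) (y := y)
    have h' := congrArg φ h
    refine h'.trans ?_
    have e : φ ((show Rack.EnvelGroup Q from Rack.toEnvelGroup Q x) *
      (show Rack.EnvelGroup Q from Rack.toEnvelGroup Q y) *
      (show Rack.EnvelGroup Q from Rack.toEnvelGroup Q x)⁻¹) = φ (Rack.toEnvelGroup Q y) := by
      rw [map_mul, map_mul, map_inv, mul_comm, inv_mul_cancel_left]
    exact e
  let c : Q →◃ Quandle.Conj (Multiplicative (ℂˣ →₀ ℤ)) :=
    { toFun := fun x => Multiplicative.ofAdd (Finsupp.single (φ (Rack.toEnvelGroup Q x)) 1)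
      map_act' := by
        intro x y
        rw [hc, Quandle.conj_act_eq_conj]
        exact (mul_inv_cancel_comm _ _).symm }
  let F : Rack.EnvelGroup Q →* Multiplicative (ℂˣ →₀ ℤ) := Rack.toEnvelGroup.map c
  let ψ : Multiplicative (ℂˣ →₀ ℤ) →* ℂˣ :=
    AddMonoidHom.toMultiplicativeLeft (Finsupp.liftAddHom (fun u : ℂˣ =>
      (zmultiplesHom (Additive ℂˣ) (Additive.ofMul u))))
  have hφ : φ = ψ.comp F := by
    refine MonoidHom.eq_of_eqOn_dense (aux_closure Q) ?_
    rintro _ ⟨x, rfl⟩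
    change _ = ψ (Multiplicative.ofAdd (Finsupp.single (φ (Rack.toEnvelGroup Q x)) 1))
    simp [ψ]
  have hF : F t = 1 := by
    obtain ⟨n, hn, h⟩ := isOfFinOrder_iff_pow_eq_one.1 ht
    have h2 : (F t) ^ n = 1 := by rw [← map_pow, h, map_one]
    have h3 : n • (Multiplicative.toAdd (F t)) = 0 := h2
    exact (smul_eq_zero.1 h3).resolve_left hn.ne'
  rw [hφ, MonoidHom.comp_apply, hF, map_one]

/-- for a finite quandle `Q`, the torsion subgroup of `Z₀` embeds into the
Schur multiplier `H²(Inn(Q), ℂˣ)`. -/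
theorem stmt18 (Q : Type*) [Quandle Q] [Finite Q] :
    ∃ T : Subgroup (Rack.EnvelGroup Q),
      (∀ z : Rack.EnvelGroup Q, z ∈ T ↔ z ∈ QdlZ0 Q ∧ IsOfFinOrder z) ∧
      ∃ f : T →* SchurMultiplier (QdlInn Q), Function.Injective f := by
  have hFG : Group.FG (Rack.EnvelGroup Q) := by
    refine Group.fg_iff.2 ⟨_, aux_closure Q, Set.finite_range _⟩
  have hFI : (QdlZ0 Q).FiniteIndex := by
    unfold QdlZ0
    infer_instance
  have hFGA : Group.FG (QdlZ0 Q) := inferInstance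
  let _ : CommGroup (QdlZ0 Q) :=
    { (inferInstance : Group (QdlZ0 Q)) with
      mul_comm := fun a b => Subtype.ext (aux_central _ a.2 _) }
  obtain ⟨hfin, r, hr⟩ := aux_retract (QdlZ0 Q)
  obtain ⟨τ, hτ⟩ := aux_tau (QdlThetaG Q) (aux_surj Q) (QdlZ0 Q).subtype
    Subtype.val_injective (fun x hx => ⟨⟨x, hx⟩, rfl⟩) (fun k => k.2)
    (fun k g => aux_central _ k.2 g)
  obtain ⟨e⟩ := CommGroup.monoidHom_mulEquiv_of_hasEnoughRootsOfUnity
    (CommGroup.torsion (QdlZ0 Q)) ℂ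
  refine ⟨(CommGroup.torsion (QdlZ0 Q)).map (QdlZ0 Q).subtype, ?_, ?_⟩
  · intro z
    constructor
    · rintro ⟨a, ha, rfl⟩
      exact ⟨a.2, (Submonoid.isOfFinOrder_coe (H := (QdlZ0 Q).toSubmonoid)).2 ha⟩
    · rintro ⟨hz, h⟩
      exact ⟨⟨z, hz⟩, (Submonoid.isOfFinOrder_coe (H := (QdlZ0 Q).toSubmonoid) (x := ⟨z, hz⟩)).1 h, rfl⟩
  · let E := (CommGroup.torsion (QdlZ0 Q)).equivMapOfInjective (QdlZ0 Q).subtype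
      Subtype.val_injective
    let D : (CommGroup.torsion (QdlZ0 Q) →* ℂˣ) →* (QdlZ0 Q →* ℂˣ) :=
      MonoidHom.mk' (fun χ => χ.comp r) (fun _ _ => rfl)
    have hD : Function.Injective (τ.comp D) := by
      rw [injective_iff_map_eq_one]
      intro χ hχ
      obtain ⟨Φ, hΦ⟩ := hτ _ hχ
      ext t
      have h1 := hΦ t
      have h0 := aux_char Φ _ ((Submonoid.isOfFinOrder_coe (H := (QdlZ0 Q).toSubmonoid)).2 t.2)
      have h2 : D χ t = χ t := congrArg χ (hr t)
      rw [← h2, ← h1]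
      exact congrArg Units.val h0
    refine ⟨(τ.comp D).comp (e.symm.toMonoidHom.comp E.symm.toMonoidHom), ?_⟩
    exact hD.comp (e.symm.injective.comp E.symm.injective)
end

section
/- Let n ≥ 1 and let S_n be the symmetric group on n letters. A representation ρ : Conj(S_n) → GL(V) of the quandle Conj(S_n) over ℂ is irreducible if and only if there exist an irreducible group representation σ : S_n → GL(V) and a map χ : S_n → ℂˣ with χ(g h g⁻¹) = χ(h) for all g,h ∈ S_n, such that ρ(g) = χ(g) σ(g) for all g ∈ S_n. -/
open scoped Quandles
/-- Extending a map on transpositions to the symmetric group. -/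
theorem aux_swapGraph {α M : Type*} [DecidableEq α] [Group M]
    (e : Equiv.Perm α → M)
    (h2 : ∀ x y : α, x ≠ y → e (Equiv.swap x y) * e (Equiv.swap x y) = 1)
    (hc : ∀ g h : Equiv.Perm α, e (g * h * g⁻¹) * e g = e g * e h)
    (S : Finset α) :
    (∀ p ∈ Subgroup.closure {p : Equiv.Perm α × M |
        ∃ x ∈ S, ∃ y ∈ S, x ≠ y ∧ p = (Equiv.swap x y, e (Equiv.swap x y))},
      (∀ a, a ∉ S → p.1 a = a) ∧ (p.1 = 1 → p = 1)) := by
  induction S using Finset.induction_on with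
  | empty =>
    intro p hp
    have : p = 1 := by simpa using hp
    subst this
    simp
  | insert a S ha ih =>
    set K := Subgroup.closure {p : Equiv.Perm α × M |
        ∃ x ∈ S, ∃ y ∈ S, x ≠ y ∧ p = (Equiv.swap x y, e (Equiv.swap x y))} with hK
    let E : α → α → Equiv.Perm α × M := fun x y => (Equiv.swap x y, e (Equiv.swap x y))
    have hEsymm : ∀ x y, E x y = E y x := fun x y => by simp only [E, Equiv.swap_comm]
    have hEK : ∀ x ∈ S, ∀ y ∈ S, x ≠ y → E x y ∈ K := fun x hx y hy hxy =>
      Subgroup.subset_closure ⟨x, hx, y, hy, hxy, rfl⟩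
    have hE2 : ∀ x y, x ≠ y → E x y * E x y = 1 := fun x y hxy => by
      simp only [E, Prod.mk_mul_mk, h2 x y hxy, Equiv.swap_mul_self]; rfl
    have hEc : ∀ (x y u v : α), E x y * E u v =
        E (Equiv.swap x y u) (Equiv.swap x y v) * E x y := fun x y u v => by
      have h1 : Equiv.swap (Equiv.swap x y u) (Equiv.swap x y v) =
          Equiv.swap x y * Equiv.swap u v * (Equiv.swap x y)⁻¹ := by
        rw [Equiv.mul_swap_eq_swap_mul]; simp
      simp only [E, Prod.mk_mul_mk, h1, hc]
      simp
    have key : ∀ p ∈ Subgroup.closure {p : Equiv.Perm α × M |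
        ∃ x ∈ insert a S, ∃ y ∈ insert a S, x ≠ y ∧
          p = (Equiv.swap x y, e (Equiv.swap x y))},
        p ∈ K ∨ ∃ b ∈ S, ∃ q ∈ K, p = E a b * q := by
      have stepa : ∀ x ∈ S, ∀ p, (p ∈ K ∨ ∃ b ∈ S, ∃ q ∈ K, p = E a b * q) →
          (E a x * p ∈ K ∨ ∃ b ∈ S, ∃ q ∈ K, E a x * p = E a b * q) := by
        intro x hx p hp
        have hax : a ≠ x := fun h => ha (h ▸ hx)
        rcases hp with hp | ⟨b, hb, q, hq, rfl⟩
        · exact Or.inr ⟨x, hx, p, hp, rfl⟩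
        · have hab : a ≠ b := fun h => ha (h ▸ hb)
          by_cases hbx : b = x
          · subst hbx
            left
            rw [← mul_assoc, hE2 _ _ hab, one_mul]; exact hq
          · right
            refine ⟨b, hb, E b x * q, K.mul_mem (hEK b hb x hx hbx) hq, ?_⟩
            rw [← mul_assoc, ← mul_assoc]
            congr 1
            rw [hEc a b b x, Equiv.swap_apply_right,
              Equiv.swap_apply_of_ne_of_ne hax.symm (Ne.symm hbx)]
      have step : ∀ x ∈ insert a S, ∀ y ∈ insert a S, x ≠ y → ∀ p,
          (p ∈ K ∨ ∃ b ∈ S, ∃ q ∈ K, p = E a b * q) →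
          (E x y * p ∈ K ∨ ∃ b ∈ S, ∃ q ∈ K, E x y * p = E a b * q) := by
        intro x hx y hy hxy p hp
        rcases Finset.mem_insert.1 hx with rfl | hx
        · rcases Finset.mem_insert.1 hy with rfl | hy
          · exact absurd rfl hxy
          · exact stepa y hy p hp
        · rcases Finset.mem_insert.1 hy with rfl | hy
          · rw [hEsymm]; exact stepa x (by assumption) p hp
          · rcases hp with hp | ⟨b, hb, q, hq, rfl⟩
            · exact Or.inl (K.mul_mem (hEK x hx y hy hxy) hp)
            · right
              refine ⟨Equiv.swap x y b, ?_, E x y * q,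
                K.mul_mem (hEK x hx y hy hxy) hq, ?_⟩
              · rw [Equiv.swap_apply_def]; split_ifs <;> assumption
              · have hax : a ≠ x := fun h => ha (h ▸ hx)
                have hay : a ≠ y := fun h => ha (h ▸ hy)
                rw [← mul_assoc, ← mul_assoc, hEc x y a b,
                  Equiv.swap_apply_of_ne_of_ne hax hay]
      intro p hp
      induction hp using Subgroup.closure_induction_left with
      | one => exact Or.inl K.one_mem
      | mul_left x hx y hy h =>
        obtain ⟨u, hu, v, hv, huv, rfl⟩ := hx
        exact step u hu v hv huv y h
      | inv_mul_cancel x hx y hy h =>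
        obtain ⟨u, hu, v, hv, huv, rfl⟩ := hx
        have : (Equiv.swap u v, e (Equiv.swap u v))⁻¹ = E u v :=
          inv_eq_of_mul_eq_one_left (hE2 u v huv)
        rw [this]
        exact step u hu v hv huv y h
    intro p hp
    rcases key p hp with hp | ⟨b, hb, q, hq, rfl⟩
    · refine ⟨fun c hcS => (ih p hp).1 c (fun h => hcS (Finset.mem_insert_of_mem h)),
        (ih p hp).2⟩
    · have hab : a ≠ b := fun h => ha (h ▸ hb)
      refine ⟨fun c hcS => ?_, fun h1 => ?_⟩
      · have hcS' : c ∉ S := fun h => hcS (Finset.mem_insert_of_mem h)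
        have hca : c ≠ a := fun h => hcS (h ▸ Finset.mem_insert_self _ _)
        have hcb : c ≠ b := fun h => hcS' (h ▸ hb)
        simp only [E, Prod.fst_mul, Equiv.Perm.mul_apply]
        rw [(ih q hq).1 c hcS', Equiv.swap_apply_of_ne_of_ne hca hcb]
      · exfalso
        have h3 := congrArg (fun f : Equiv.Perm α => f a) h1
        simp only [E, Prod.fst_mul, Equiv.Perm.mul_apply] at h3
        rw [(ih q hq).1 a ha, Equiv.swap_apply_left] at h3
        exact hab h3.symm

theorem aux_swapExtend {α M : Type*} [DecidableEq α] [Fintype α] [Group M]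
    (e : Equiv.Perm α → M)
    (h2 : ∀ x y : α, x ≠ y → e (Equiv.swap x y) * e (Equiv.swap x y) = 1)
    (hc : ∀ g h : Equiv.Perm α, e (g * h * g⁻¹) * e g = e g * e h) :
    ∃ σ : Equiv.Perm α →* M, ∀ x y : α, x ≠ y →
      σ (Equiv.swap x y) = e (Equiv.swap x y) := by
  have hK := aux_swapGraph e h2 hc Finset.univ
  set K := Subgroup.closure {p : Equiv.Perm α × M |
        ∃ x ∈ Finset.univ, ∃ y ∈ Finset.univ, x ≠ y ∧
          p = (Equiv.swap x y, e (Equiv.swap x y))}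
  have hgen : ∀ x y : α, x ≠ y → (Equiv.swap x y, e (Equiv.swap x y)) ∈ K :=
    fun x y hxy => Subgroup.subset_closure
      ⟨x, Finset.mem_univ _, y, Finset.mem_univ _, hxy, rfl⟩
  let f : K →* Equiv.Perm α := (MonoidHom.fst _ _).comp K.subtype
  have hinj : Function.Injective f := by
    rw [injective_iff_map_eq_one]
    intro p hp
    exact Subtype.ext ((hK p.1 p.2).2 hp)
  have hsurj : Function.Surjective f := by
    rw [← MonoidHom.range_eq_top, eq_top_iff, ← Equiv.Perm.closure_isSwap,
      Subgroup.closure_le]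
    rintro _ ⟨x, y, hxy, rfl⟩
    exact ⟨⟨_, hgen x y hxy⟩, rfl⟩
  let F : K ≃* Equiv.Perm α := MulEquiv.ofBijective f ⟨hinj, hsurj⟩
  refine ⟨((MonoidHom.snd _ _).comp K.subtype).comp F.symm.toMonoidHom, fun x y hxy => ?_⟩
  have : F.symm (Equiv.swap x y) = ⟨_, hgen x y hxy⟩ := by
    rw [MulEquiv.symm_apply_eq]; rfl
  simp [this]

/-- Schur's lemma for a countable irreducible family. -/
theorem aux_schur {Q V : Type*} [Countable Q] [AddCommGroup V] [Module ℂ V] [Nontrivial V]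
    (ρ : Q → (V →ₗ[ℂ] V)ˣ) (hirr : QdlIrred ρ) (z : V →ₗ[ℂ] V)
    (hz : ∀ x v, z ((ρ x : V →ₗ[ℂ] V) v) = (ρ x : V →ₗ[ℂ] V) (z v)) :
    ∃ c : ℂ, z = algebraMap ℂ (V →ₗ[ℂ] V) c := by
  by_contra hcon
  push Not at hcon
  have hinj : ∀ c, Function.Injective (z - algebraMap ℂ (V →ₗ[ℂ] V) c) := by
    intro c
    rw [← LinearMap.ker_eq_bot]
    refine (hirr _ ?_).resolve_right ?_
    · intro x v hv
      simp only [LinearMap.mem_ker, LinearMap.sub_apply, Module.algebraMap_end_apply] at hv ⊢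
      rw [hz, ← map_smul, ← map_sub, hv, map_zero]
    · intro h
      exact hcon c (sub_eq_zero.1 (LinearMap.ker_eq_top.1 h))
  have hsurj : ∀ c, Function.Surjective (z - algebraMap ℂ (V →ₗ[ℂ] V) c) := by
    intro c
    rw [← LinearMap.range_eq_top]
    refine (hirr _ ?_).resolve_left ?_
    · rintro x _ ⟨v, rfl⟩
      refine ⟨(ρ x : V →ₗ[ℂ] V) v, ?_⟩
      simp only [LinearMap.sub_apply, Module.algebraMap_end_apply]
      rw [hz, ← map_smul, ← map_sub]
    · intro h
      exact hcon c (sub_eq_zero.1 (LinearMap.range_eq_bot.1 h))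
  have hpoly : ∀ p : Polynomial ℂ, p ≠ 0 → Function.Injective (Polynomial.aeval z p) := by
    intro p hp
    have hs := IsAlgClosed.splits p
    rw [hs.eq_prod_roots, map_mul, Polynomial.aeval_C]
    have h1 : ∀ m : Multiset ℂ, Function.Injective
        (Polynomial.aeval z (m.map (fun a => Polynomial.X - Polynomial.C a)).prod) := by
      intro m
      induction m using Multiset.induction_on with
      | empty => intro a b hab; simpa using hab
      | cons a m ih =>
        rw [Multiset.map_cons, Multiset.prod_cons, map_mul]
        have : Polynomial.aeval z (Polynomial.X - Polynomial.C a) =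
          z - algebraMap ℂ (V →ₗ[ℂ] V) a := by simp
        rw [this]
        exact (hinj a).comp ih
    refine Function.Injective.comp (g := (algebraMap ℂ (V →ₗ[ℂ] V) p.leadingCoeff)) ?_ (h1 _)
    intro a b hab
    simp only [Module.algebraMap_end_apply] at hab
    exact smul_right_injective V (Polynomial.leadingCoeff_ne_zero.2 hp) hab
  obtain ⟨v, hv⟩ := exists_ne (0 : V)
  choose w hw using fun c => hsurj c v
  have hli : LinearIndependent ℂ w := by
    rw [linearIndependent_iff']
    intro s a hs c0 hc0
    by_contra hne
    let q : Polynomial ℂ := ∑ c ∈ s, Polynomial.C (a c) *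
      ∏ b ∈ s.erase c, (Polynomial.X - Polynomial.C b)
    have hq : q ≠ 0 := by
      intro h0
      have h1 := congrArg (Polynomial.eval c0) h0
      simp only [q, Polynomial.eval_finsetSum, Polynomial.eval_mul, Polynomial.eval_C,
        Polynomial.eval_prod, Polynomial.eval_sub, Polynomial.eval_X,
        Polynomial.eval_zero] at h1
      rw [Finset.sum_eq_single_of_mem c0 hc0] at h1
      · refine (mul_ne_zero hne (Finset.prod_ne_zero_iff.2 fun b hb => ?_)) h1
        exact sub_ne_zero.2 (Finset.ne_of_mem_erase hb).symm
      · intro b _ hb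
        rw [Finset.prod_eq_zero (Finset.mem_erase.2 ⟨hb.symm, hc0⟩) (sub_self _), mul_zero]
    have hqv : Polynomial.aeval z q v = 0 := by
      have h1 := congrArg (Polynomial.aeval z
        (∏ b ∈ s, (Polynomial.X - Polynomial.C b))) hs
      rw [map_zero, map_sum] at h1
      rw [← h1]
      simp only [q, map_sum, LinearMap.sum_apply]
      refine Finset.sum_congr rfl fun c hc => ?_
      rw [map_smul, ← Finset.prod_erase_mul _ _ hc, map_mul (Polynomial.aeval z),
        map_mul (Polynomial.aeval z), Polynomial.aeval_C]
      have : Polynomial.aeval z (Polynomial.X - Polynomial.C c) =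
          z - algebraMap ℂ (V →ₗ[ℂ] V) c := by simp
      rw [this, Module.End.mul_apply, Module.End.mul_apply, hw, Module.algebraMap_end_apply]
    exact hv (hpoly q hq (by rw [hqv, map_zero]))
  let S : Set V := Set.range fun l : List Q => (((l.map ρ).prod : (V →ₗ[ℂ] V)ˣ) : V →ₗ[ℂ] V) v
  have hS : S.Countable := Set.countable_range _
  have htop : Submodule.span ℂ S = ⊤ := by
    refine (hirr _ ?_).resolve_left ?_
    · intro x u hu
      induction hu using Submodule.span_induction with
      | mem u hu =>
        obtain ⟨l, rfl⟩ := hu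
        refine Submodule.subset_span ⟨x :: l, ?_⟩
        simp
      | zero => simp
      | add a b _ _ ha hb => rw [map_add]; exact Submodule.add_mem _ ha hb
      | smul c a _ ha => rw [map_smul]; exact Submodule.smul_mem _ _ ha
    · intro h
      have : v ∈ Submodule.span ℂ S := Submodule.subset_span ⟨[], by simp⟩
      rw [h] at this
      exact hv (by simpa using this)
  have hrank : Module.rank ℂ V ≤ Cardinal.aleph0 := by
    rw [← rank_top ℂ V, ← htop]
    exact (rank_span_le S).trans (Cardinal.le_aleph0_iff_set_countable.2 hS)
  have h1 := hli.cardinal_lift_le_rank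
  have h2 : Cardinal.lift.{0} (Module.rank ℂ V) ≤ Cardinal.aleph0 := by
    simpa using hrank
  have h3 := h1.trans h2
  rw [Cardinal.mk_complex, Cardinal.lift_continuum] at h3
  exact absurd h3 (not_le.2 Cardinal.aleph0_lt_continuum)

/-- a representation of the quandle `Conj(Sₙ)` (`n ≥ 1`) is irreducible iff
it is the product of a conjugation-invariant `ℂˣ`-valued function and an irreducible linear
representation of the symmetric group `Sₙ`. -/
theorem stmt19 (n : ℕ) (hn : 1 ≤ n)
    (V : Type*) [AddCommGroup V] [Module ℂ V]
    (ρ : Equiv.Perm (Fin n) → (V →ₗ[ℂ] V)ˣ)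
    (hρ : ∀ g h : Equiv.Perm (Fin n), ρ (g * h * g⁻¹) = ρ g * ρ h * (ρ g)⁻¹) :
    QdlIrred ρ ↔
      ∃ (σ : Equiv.Perm (Fin n) →* (V →ₗ[ℂ] V)ˣ) (χ : Equiv.Perm (Fin n) → ℂˣ),
        GrpIrred σ ∧ (∀ g h : Equiv.Perm (Fin n), χ (g * h * g⁻¹) = χ h) ∧
        ∀ g : Equiv.Perm (Fin n), (ρ g : V →ₗ[ℂ] V) = (χ g : ℂ) • (σ g : V →ₗ[ℂ] V) := by
  constructor
  · intro hirr
    rcases subsingleton_or_nontrivial V with hV | hV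
    · refine ⟨1, fun _ => 1, fun W _ => Or.inl (Subsingleton.elim _ _), fun _ _ => rfl,
        fun g => ?_⟩
      ext v
      exact Subsingleton.elim _ _
    let ι : ℂˣ →* (V →ₗ[ℂ] V)ˣ := Units.map (algebraMap ℂ (V →ₗ[ℂ] V)).toMonoidHom
    have hιc : ∀ c u, ι c * u = u * ι c := fun c u =>
      Units.ext (Algebra.commutes (c : ℂ) (u : V →ₗ[ℂ] V))
    have hιi : Function.Injective ι := by
      intro a b h
      have h1 := congrArg Units.val h
      exact Units.ext ((algebraMap ℂ (V →ₗ[ℂ] V)).injective h1)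
    have hschur : ∀ u : (V →ₗ[ℂ] V)ˣ, (∀ x, u * ρ x = ρ x * u) → ∃ c, u = ι c := by
      intro u hu
      obtain ⟨c, hc⟩ := aux_schur ρ hirr (u : V →ₗ[ℂ] V) (fun x v => by
        have := congrArg Units.val (hu x)
        exact LinearMap.congr_fun this v)
      have hc0 : c ≠ 0 := by
        rintro rfl
        rw [map_zero] at hc
        exact u.ne_zero hc
      exact ⟨Units.mk0 c hc0, Units.ext hc⟩
    have hcomm : ∀ g h, ρ (g * h * g⁻¹) * ρ g = ρ g * ρ h := fun g h => by
      rw [hρ]; group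
    have hsq : ∃ c : ℂˣ, ∀ x y, x ≠ y →
        ρ (Equiv.swap x y) * ρ (Equiv.swap x y) = ι c := by
      by_cases hex : ∃ x y : Fin n, x ≠ y
      · obtain ⟨x0, y0, h0⟩ := hex
        obtain ⟨c, hc⟩ := hschur (ρ (Equiv.swap x0 y0) * ρ (Equiv.swap x0 y0)) (fun x => by
          rw [mul_assoc, ← hcomm, ← mul_assoc, ← hcomm, mul_assoc]
          congr 2
          simp [mul_assoc])
        refine ⟨c, fun x y hxy => ?_⟩
        obtain ⟨g, hg⟩ := isConj_iff.1 (Equiv.Perm.isConj_swap h0 hxy)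
        rw [← hg, hρ]
        calc _ = ρ g * (ρ (Equiv.swap x0 y0) * ρ (Equiv.swap x0 y0)) * (ρ g)⁻¹ := by group
          _ = _ := by rw [hc, ← hιc]; group
      · push Not at hex
        exact ⟨1, fun x y hxy => absurd (hex x y) hxy⟩
    obtain ⟨c, hc⟩ := hsq
    obtain ⟨d0, hd0⟩ := IsAlgClosed.exists_pow_nat_eq (c : ℂ) (n := 2) (by norm_num)
    have hd00 : d0 ≠ 0 := by
      rintro rfl
      exact c.ne_zero (by rw [← hd0]; simp)
    obtain ⟨d, hd⟩ : ∃ d : ℂˣ, d * d = c :=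
      ⟨Units.mk0 d0 hd00, Units.ext (by simp [← hd0, sq])⟩
    obtain ⟨σ, hσ⟩ := aux_swapExtend (fun g => ι d⁻¹ * ρ g)
      (fun x y hxy => by
        have : ι d⁻¹ * ρ (Equiv.swap x y) * (ι d⁻¹ * ρ (Equiv.swap x y)) =
            ι d⁻¹ * ι d⁻¹ * (ρ (Equiv.swap x y) * ρ (Equiv.swap x y)) := by
          rw [mul_assoc, ← mul_assoc (ρ _) (ι _), ← hιc]; group
        simp only [this]
        rw [hc x y hxy, ← hd, ← map_mul, ← map_mul]
        simp)
      (fun g h => by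
        have : ∀ u v : (V →ₗ[ℂ] V)ˣ, ι d⁻¹ * u * (ι d⁻¹ * v) = ι d⁻¹ * ι d⁻¹ * (u * v) := by
          intro u v
          rw [mul_assoc, ← mul_assoc u, ← hιc]; simp only [mul_assoc]
        simp only [this, hcomm])
    have hσρ : ∀ g x, σ g * ρ x = ρ (g * x * g⁻¹) * σ g := by
      intro g
      have hg : g ∈ Subgroup.closure {σ : Equiv.Perm (Fin n) | σ.IsSwap} := by
        rw [Equiv.Perm.closure_isSwap]; trivial
      have hsw : ∀ t : Equiv.Perm (Fin n), t.IsSwap →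
          ∀ x, σ t * ρ x = ρ (t * x * t⁻¹) * σ t := by
        rintro _ ⟨a, b, hab, rfl⟩ x
        simp only [hσ a b hab]
        rw [mul_assoc, ← hcomm, ← mul_assoc, hιc, mul_assoc]
      induction hg using Subgroup.closure_induction with
      | mem t ht => exact hsw t ht
      | one => intro x; simp
      | mul a b _ _ iha ihb =>
        intro x
        rw [map_mul, mul_assoc, ihb, ← mul_assoc, iha, mul_assoc]
        congr 2
      | inv a _ iha =>
        intro x
        rw [map_inv, inv_mul_eq_iff_eq_mul, ← mul_assoc, iha, mul_assoc, mul_inv_cancel,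
          mul_one]
        congr 1
        group
    have hχ : ∀ g, ∃ c, ρ g = ι c * σ g := by
      intro g
      obtain ⟨c, hc⟩ := hschur (ρ g * (σ g)⁻¹) (fun x => by
        have h1 := hσρ g (g⁻¹ * x * g)
        have h2 := hcomm g (g⁻¹ * x * g)
        have h3 : g * (g⁻¹ * x * g) * g⁻¹ = x := by group
        rw [h3] at h1 h2
        have h4 : (σ g)⁻¹ * ρ x = ρ (g⁻¹ * x * g) * (σ g)⁻¹ := by
          rw [inv_mul_eq_iff_eq_mul, ← mul_assoc, h1]; group
        rw [mul_assoc, h4, ← mul_assoc, ← h2, mul_assoc])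
      exact ⟨c, by rw [← hc]; group⟩
    choose χ hχ using hχ
    have hfin : ∀ g, (ρ g : V →ₗ[ℂ] V) = (χ g : ℂ) • (σ g : V →ₗ[ℂ] V) := by
      intro g
      rw [hχ g, Algebra.smul_def]
      rfl
    refine ⟨σ, χ, fun W hW => hirr W fun x v hv => ?_, fun g h => ?_, hfin⟩
    · rw [hfin]
      exact W.smul_mem _ (hW x v hv)
    · apply hιi
      have h1 := hσρ g h
      have h2 : g * h * g⁻¹ * g = g * h := by group
      rw [hχ (g * h * g⁻¹), hχ h, ← mul_assoc, ← hιc, mul_assoc, mul_assoc, ← map_mul,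
        ← map_mul, h2] at h1
      exact (mul_right_cancel h1).symm
  · rintro ⟨σ, χ, hσ, -, h⟩ W hW
    refine hσ W fun g v hv => ?_
    have h1 := W.smul_mem ((χ g : ℂ)⁻¹) (hW g v hv)
    rwa [h, LinearMap.smul_apply, inv_smul_smul₀ (χ g).ne_zero] at h1
end
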